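/- arXiv:0706.4203 — 3 statements merged into one kernel-verified Lean document; each statement's English description precedes it below -/
import Mathlib

section
/- Let p be a prime, n ≥ 1, and q = p^n with q ≠ 2 and q ≠ 3. Let m = ⌊2√q⌋ (equivalently, m = ⌊√(4q)⌋). If m² − 4q ∈ {−3, −4, −7, −8, −11, −19}, then p does not divide m. -/
theorem stmt_0 (p n q m : ℕ) (hp : p.Prime) (hn : 1 ≤ n) (hq : q = p ^ n)
    (hq2 : q ≠ 2) (hq3 : q ≠ 3) (hm : m = Nat.sqrt (4 * q))
    (hd : (m : ℤ) ^ 2 - 4 * (q : ℤ) ∈ ({-3, -4, -7, -8, -11, -19} : Set ℤ)) :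
    ¬ p ∣ m := by
  rintro ⟨j, hj⟩
  simp only [Set.mem_insert_iff, Set.mem_singleton_iff] at hd
  obtain rfl | hn2 : n = 1 ∨ 2 ≤ n := by omega
  · rw [pow_one] at hq
    subst hq
    have hdvd : (q : ℤ) ∣ (m : ℤ) ^ 2 - 4 * q := ⟨q * j ^ 2 - 4, by rw [hj]; push_cast; ring⟩
    have hle : q ≤ 19 := by
      rcases hd with h | h | h | h | h | h <;> rw [h] at hdvd <;>
        have := Int.le_of_dvd (by norm_num) (dvd_neg.mpr hdvd) <;> omega
    clear hdvd hd
    have hsq := Nat.sqrt_le' (4 * q)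
    have hlt := Nat.lt_succ_sqrt' (4 * q)
    have hq5 : 5 ≤ q := by
      have := hp.two_le
      have : q ≠ 4 := by rintro rfl; norm_num at hp
      omega
    rw [← hm, hj] at hsq hlt
    -- `q ≥ 5` forces `0 < m < q`, so `q` cannot divide `m`.
    obtain rfl | hj0 := Nat.eq_zero_or_pos j
    · simp at hlt; omega
    · have : q * 1 ≤ q * j := Nat.mul_le_mul_left q hj0
      nlinarith
  · obtain ⟨k, hk⟩ : p ^ 2 ∣ q := hq ▸ pow_dvd_pow p hn2
    have hdvd : (p : ℤ) ^ 2 ∣ (m : ℤ) ^ 2 - 4 * q :=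
      ⟨j ^ 2 - 4 * k, by rw [hj, hk]; push_cast; ring⟩
    have hp2 : p = 2 := by
      have := hp.two_le
      have hle : p ≤ 4 := by
        rcases hd with h | h | h | h | h | h <;> rw [h] at hdvd <;>
          have := Int.le_of_dvd (by norm_num) (dvd_neg.mpr hdvd) <;> nlinarith
      interval_cases p
      · rfl
      · norm_num at hdvd; omega
      · norm_num at hp
    subst hp2
    have hmod : (j : ℤ) ^ 2 % 4 = 0 ∨ (j : ℤ) ^ 2 % 4 = 1 := by
      rcases Int.even_or_odd' (j : ℤ) with ⟨i, h | h⟩ <;> rw [h] <;> ring_nf <;> omega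
    rw [hj, hk] at hd
    push_cast at hd
    rw [mul_pow] at hd
    omega
end

section
/- Let p be a prime, n ≥ 1, and q = p^n with q ≠ 2 and q ≠ 3, and set m = ⌊2√q⌋. Suppose m² − 4q ∈ {−3, −4, −7, −8, −11, −19}. If E is an elliptic curve over the finite field F_q whose number of F_q-rational points equals q + 1 + m or q + 1 − m, then p does not divide the Frobenius trace q + 1 − #E(F_q). -/
/-- If `m ^ 2 - 4 * p ^ n` is one of `-3, -4, -7, -8, -11, -19` and `p ^ n` is neither `2` nor `3`,
then the prime `p` does not divide `m`. -/
theorem not_dvd_of_sq_sub_four_mul_prime_pow_mem {p n : ℕ} {m : ℤ} (hp : p.Prime) (hn : 1 ≤ n)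
    (h2 : p ^ n ≠ 2) (h3 : p ^ n ≠ 3)
    (hd : m ^ 2 - 4 * ((p ^ n : ℕ) : ℤ) ∈ ({-3, -4, -7, -8, -11, -19} : Set ℤ)) :
    ¬ (p : ℤ) ∣ m := by
  rintro ⟨k, rfl⟩
  simp only [Set.mem_insert_iff, Set.mem_singleton_iff] at hd
  have hdvd : (p : ℤ) ∣ (p * k) ^ 2 - 4 * ((p ^ n : ℕ) : ℤ) :=
    dvd_sub ((dvd_mul_right _ _).pow two_ne_zero)
      ((Int.natCast_dvd_natCast.2 (dvd_pow_self p (by lia))).mul_left 4)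
  have hle : p ≤ 19 := by
    have hle' := Int.le_of_dvd (a := (p : ℤ)) (by lia) (dvd_neg.2 hdvd)
    lia
  have hk : k ^ 2 % 4 = 0 ∨ k ^ 2 % 4 = 1 := by
    rcases Int.even_or_odd' k with ⟨c, rfl | rfl⟩ <;> ring_nf <;> lia
  have hq : p ^ n = p ∨ ∃ t, p ^ n = p ^ 2 * t := by
    rcases hn.eq_or_lt with rfl | hn
    · exact .inl (pow_one p)
    · exact .inr (pow_dvd_pow p hn)
  rw [mul_pow] at hd hdvd
  generalize k ^ 2 = K at *
  generalize p ^ n = q at *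
  have := hp.two_le
  interval_cases p <;> first
    | (revert hp; norm_num; done)
    | (rcases hq with rfl | ⟨t, rfl⟩ <;> push_cast at * <;> omega)


theorem stmt_1 (p n q m : ℕ) (hp : p.Prime) (hn : 1 ≤ n) (hq : q = p ^ n)
    (hq2 : q ≠ 2) (hq3 : q ≠ 3) (hm : m = Nat.sqrt (4 * q))
    (hd : (m : ℤ) ^ 2 - 4 * (q : ℤ) ∈ ({-3, -4, -7, -8, -11, -19} : Set ℤ))
    (F : Type) [Field F] [Fintype F] (hF : Fintype.card F = q)
    (E : WeierstrassCurve F) [E.IsElliptic]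
    (hE : (Nat.card E.toAffine.Point : ℤ) = (q : ℤ) + 1 + m ∨
          (Nat.card E.toAffine.Point : ℤ) = (q : ℤ) + 1 - m) :
    ¬ (p : ℤ) ∣ ((q : ℤ) + 1 - Nat.card E.toAffine.Point) := by
  subst hq
  have hpm := not_dvd_of_sq_sub_four_mul_prime_pow_mem hp hn hq2 hq3 hd
  rcases hE with hE | hE <;> rw [hE]
  · rwa [sub_add_cancel_left, dvd_neg]
  · rwa [sub_sub_cancel]
end

section
/- There is no prime p ∈ {2, 5, 7} and natural number n ≥ 1 such that ⌊2√(p^n)⌋² − 4·p^n = −8. -/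
/-- A discriminant equation `m ^ 2 - 4 q = -8` forces `q` to be of the form `k ^ 2 + 2`. -/
theorem exists_sq_add_two_of_sq_sub_eq_neg_eight {m q : ℤ} (h : m ^ 2 - 4 * q = -8) :
    ∃ k : ℤ, k ^ 2 + 2 = q := by
  have hm : Even (m ^ 2) := ⟨2 * q - 4, by linarith⟩
  obtain ⟨k, rfl⟩ := (Int.even_pow.mp hm).1
  exact ⟨k, by linarith⟩

theorem not_four_dvd_sq_add_two (k : ℤ) : ¬ (4 : ℤ) ∣ k ^ 2 + 2 := by
  have key : ∀ x : ZMod 4, x ^ 2 + 2 ≠ 0 := by decide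
  intro h
  exact key k (by exact_mod_cast (ZMod.intCast_zmod_eq_zero_iff_dvd _ 4).mpr h)

theorem not_five_dvd_sq_add_two (k : ℤ) : ¬ (5 : ℤ) ∣ k ^ 2 + 2 := by
  have key : ∀ x : ZMod 5, x ^ 2 + 2 ≠ 0 := by decide
  intro h
  exact key k (by exact_mod_cast (ZMod.intCast_zmod_eq_zero_iff_dvd _ 5).mpr h)

theorem not_seven_dvd_sq_add_two (k : ℤ) : ¬ (7 : ℤ) ∣ k ^ 2 + 2 := by
  have key : ∀ x : ZMod 7, x ^ 2 + 2 ≠ 0 := by decide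
  intro h
  exact key k (by exact_mod_cast (ZMod.intCast_zmod_eq_zero_iff_dvd _ 7).mpr h)

theorem stmt_10 :
    ¬ ∃ (p n : ℕ), p.Prime ∧ p ∈ ({2, 5, 7} : Set ℕ) ∧ 1 ≤ n ∧
      (Nat.sqrt (4 * p ^ n) : ℤ) ^ 2 - 4 * (p ^ n : ℤ) = -8 := by
  rintro ⟨p, n, -, hp, hn, h⟩
  obtain ⟨k, hq⟩ := exists_sq_add_two_of_sq_sub_eq_neg_eight h
  have hn0 : n ≠ 0 := by omega
  rcases hp with rfl | rfl | rfl
  · obtain rfl | hn2 : n = 1 ∨ 2 ≤ n := by omega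
    · have hs : Nat.sqrt (4 * 2 ^ 1) = 2 := by norm_num
      rw [hs] at h
      norm_num at h
    · refine not_four_dvd_sq_add_two k (hq ▸ ?_)
      exact_mod_cast pow_dvd_pow 2 hn2
  · exact not_five_dvd_sq_add_two k (hq ▸ by exact_mod_cast dvd_pow_self 5 hn0)
  · exact not_seven_dvd_sq_add_two k (hq ▸ by exact_mod_cast dvd_pow_self 7 hn0)
end
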